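/- (Theorem 2.2, hyper-symplectic condition) Let ω and χ be the bilinear forms on V = (ℝⁿ)⁴ given by ω(v,v') = ⟨p,x'⟩ − ⟨x,p'⟩ + ⟨q,y'⟩ − ⟨y,q'⟩ and χ(v,v') = ⟨x,y'⟩ − ⟨y,x'⟩ − ⟨p,q'⟩ + ⟨q,p'⟩. If A : V → V is a linear map satisfying χ(v,v') = ω(A v, v') for all v, v' ∈ V, then A ∘ A = −Id; that is, the recursion operator ω⁻¹χ squares to minus the identity. -/

import Mathlib

/-- Model of ℝⁿ in the paper's local coordinates. -/
abbrev E (n : ℕ) := Fin n → ℝ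

/-- The linear model `V = ℝⁿ × ℝⁿ × ℝⁿ × ℝⁿ`, a vector `v = (x, y, p, q)`. -/
abbrev V (n : ℕ) := E n × E n × E n × E n

/-- The standard inner product on ℝⁿ. -/
def dot {n : ℕ} (x y : E n) : ℝ := ∑ i, x i * y i

/-- The symplectic form `ω = dp∧dx + dq∧dy`:
`ω(v,v') = ⟨p,x'⟩ - ⟨x,p'⟩ + ⟨q,y'⟩ - ⟨y,q'⟩` for `v = (x,y,p,q)`. -/
def omegaForm {n : ℕ} (v v' : V n) : ℝ :=
  dot v.2.2.1 v'.1 - dot v.1 v'.2.2.1 + dot v.2.2.2 v'.2.1 - dot v.2.1 v'.2.2.2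

/-- The symplectic form `χ = -dp∧dq + dx∧dy`:
`χ(v,v') = ⟨x,y'⟩ - ⟨y,x'⟩ - ⟨p,q'⟩ + ⟨q,p'⟩` for `v = (x,y,p,q)`. -/
def chiForm {n : ℕ} (v v' : V n) : ℝ :=
  dot v.1 v'.2.1 - dot v.2.1 v'.1 - dot v.2.2.1 v'.2.2.2 + dot v.2.2.2 v'.2.2.1

theorem dot_single {n : ℕ} (x : E n) (i : Fin n) : dot x (Pi.single i 1) = x i := by
  simp [dot, Pi.single_apply]

theorem dot_zero {n : ℕ} (x : E n) : dot x 0 = 0 := by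
  simp [dot]

/-- The recursion operator is `(x, y, p, q) ↦ (-q, p, -y, x)`. -/
theorem eq_of_chiForm_eq_omegaForm {n : ℕ} {v w : V n}
    (h : ∀ v' : V n, chiForm v v' = omegaForm w v') :
    w = (-v.2.2.2, v.2.2.1, -v.2.1, v.1) := by
  refine Prod.ext ?_ (Prod.ext ?_ (Prod.ext ?_ ?_)) <;> funext i
  · have := h (0, 0, Pi.single i 1, 0)
    simp only [chiForm, omegaForm, dot_single, dot_zero] at this
    simp only [Pi.neg_apply]
    linarith
  · have := h (0, 0, 0, Pi.single i 1)
    simp only [chiForm, omegaForm, dot_single, dot_zero] at this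
    linarith
  · have := h (Pi.single i 1, 0, 0, 0)
    simp only [chiForm, omegaForm, dot_single, dot_zero] at this
    simp only [Pi.neg_apply]
    linarith
  · have := h (0, Pi.single i 1, 0, 0)
    simp only [chiForm, omegaForm, dot_single, dot_zero] at this
    linarith

/-- Theorem 2.2, hyper-symplectic condition: if a linear map
`A : V → V` satisfies `χ(v,v') = ω(A v, v')` for all `v, v'`, then `A ∘ A = -Id`;
that is, the recursion operator `ω⁻¹χ` squares to minus the identity. -/
theorem recursion_operator_sq_eq_neg_id (n : ℕ) (hn : 1 ≤ n)
    (A : V n →ₗ[ℝ] V n)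
    (hA : ∀ v v' : V n, chiForm v v' = omegaForm (A v) v') :
    A ∘ₗ A = -LinearMap.id := by
  have hv (v : V n) := eq_of_chiForm_eq_omegaForm (hA v)
  refine LinearMap.ext fun v => ?_
  rw [LinearMap.comp_apply, hv (A v), hv v]
  rfl
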